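/- Let B : ℝ → ℝ be infinitely differentiable (C^∞) with B 0 = 1, B x > 0 for all x in a neighborhood of 0, and B d-even at 0. Then there exist ε > 0 and a function r̃ : ℝ → ℝ, infinitely differentiable on the interval (-ε, ε), such that: r̃ 0 = 0, deriv r̃ 0 = 1, r̃ is d-odd at 0 (iteratedDeriv (2k) r̃ 0 = 0 for all k ∈ ℕ), and for all r ∈ (0, ε), r * deriv r̃ r = Real.sqrt (B r) * r̃ r. -/

import Mathlib

open scoped ContDiff in
theorem hasDerivAt_integral_pow_mul_comp_mul {g : ℝ → ℝ} (hg : ContDiff ℝ ∞ g) (k : ℕ) (x : ℝ) :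
    HasDerivAt (fun x => ∫ t in (0 : ℝ)..1, t ^ k * g (x * t))
      (∫ t in (0 : ℝ)..1, t ^ (k + 1) * deriv g (x * t)) x := by
  have hg' : ContDiff ℝ ∞ (deriv g) := (contDiff_infty_iff_deriv.1 hg).2
  have hgc : Continuous g := hg.continuous
  have hgc' : Continuous (deriv g) := hg'.continuous
  obtain ⟨C, hC⟩ := ((isCompact_closedBall x 1).prod
    (isCompact_Icc (a := (0 : ℝ)) (b := 1))).exists_bound_of_continuousOn
      (f := fun p : ℝ × ℝ => p.2 ^ (k + 1) * deriv g (p.1 * p.2))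
      (by fun_prop)
  refine (intervalIntegral.hasDerivAt_integral_of_dominated_loc_of_deriv_le
    (F := fun x t => t ^ k * g (x * t)) (F' := fun x t => t ^ (k + 1) * deriv g (x * t))
    (bound := fun _ => C) (Metric.closedBall_mem_nhds x one_pos) ?_ ?_ ?_ ?_ ?_ ?_).2
  · exact Filter.Eventually.of_forall fun y =>
      (by fun_prop : Continuous fun t => t ^ k * g (y * t)).aestronglyMeasurable
  · exact (by fun_prop : Continuous fun t => t ^ k * g (x * t)).intervalIntegrable _ _
  · exact (by fun_prop :
      Continuous fun t => t ^ (k + 1) * deriv g (x * t)).aestronglyMeasurable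
  · refine Filter.Eventually.of_forall fun t ht y hy => hC (y, t) ⟨hy, ?_⟩
    rw [Set.uIoc_of_le zero_le_one] at ht
    exact Set.Ioc_subset_Icc_self ht
  · exact intervalIntegrable_const
  · refine Filter.Eventually.of_forall fun t _ y _ => ?_
    have hgd : HasDerivAt g (deriv g (y * t)) (y * t) :=
      (hg.differentiable (by simp) _).hasDerivAt
    have h := (hgd.comp y ((hasDerivAt_id y).mul_const t)).const_mul (t ^ k)
    refine h.congr_deriv ?_
    ring

open scoped ContDiff in
theorem contDiff_integral_pow_mul_comp_mul {g : ℝ → ℝ} (hg : ContDiff ℝ ∞ g) (k : ℕ) :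
    ContDiff ℝ ∞ fun x => ∫ t in (0 : ℝ)..1, t ^ k * g (x * t) := by
  refine contDiff_infty.2 fun n => ?_
  induction n generalizing g k with
  | zero =>
    refine contDiff_zero.2 (continuous_iff_continuousAt.2 fun x => ?_)
    exact (hasDerivAt_integral_pow_mul_comp_mul hg k x).continuousAt
  | succ n ih =>
    have hd := hasDerivAt_integral_pow_mul_comp_mul hg k
    rw [Nat.cast_succ]
    refine contDiff_succ_iff_deriv.2
      ⟨fun x => (hd x).differentiableAt, fun h => absurd h (by simp), ?_⟩
    rw [funext fun x => (hd x).deriv]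
    exact ih (contDiff_infty_iff_deriv.1 hg).2 (k + 1)

open scoped ContDiff in
/-- Hadamard's lemma in one variable. -/
theorem exists_contDiff_eq_add_mul {f : ℝ → ℝ} (hf : ContDiff ℝ ∞ f) :
    ∃ q : ℝ → ℝ, ContDiff ℝ ∞ q ∧ ∀ x, f x = f 0 + x * q x := by
  have hf' : ContDiff ℝ ∞ (deriv f) := (contDiff_infty_iff_deriv.1 hf).2
  refine ⟨_, contDiff_integral_pow_mul_comp_mul hf' 0, fun x => ?_⟩
  have h := intervalIntegral.smul_integral_comp_mul_left (a := 0) (b := 1) (deriv f) x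
  rw [intervalIntegral.integral_deriv_eq_sub (fun y _ => hf.differentiable (by simp) y)
    (hf'.continuous.intervalIntegrable _ _)] at h
  simp only [smul_eq_mul, mul_zero, mul_one] at h
  simp only [pow_zero, one_mul]
  linarith

open scoped ContDiff in
/-- The odd derivatives at `0` of `f` vanish if those of `f * f` do and `f 0 ≠ 0`. -/
theorem iteratedDeriv_odd_eq_zero_of_mul_self {f : ℝ → ℝ} (hf : ContDiff ℝ ∞ f) (hf0 : f 0 ≠ 0)
    (h : ∀ k : ℕ, iteratedDeriv (2 * k + 1) (f * f) 0 = 0) (k : ℕ) :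
    iteratedDeriv (2 * k + 1) f 0 = 0 := by
  induction k using Nat.strong_induction_on with
  | _ k ih =>
    have hn : ContDiffAt ℝ ((2 * k + 1 : ℕ) : ℕ∞ω) f 0 := (contDiff_infty.1 hf _).contDiffAt
    have hk := h k
    rw [iteratedDeriv_mul hn hn, Finset.sum_range_succ, Finset.sum_range_succ',
      Finset.sum_eq_zero] at hk
    · simp only [Nat.choose_zero_right, Nat.choose_self, Nat.cast_one, one_mul, Nat.sub_self,
        Nat.sub_zero, iteratedDeriv_zero] at hk
      have : f 0 * iteratedDeriv (2 * k + 1) f 0 = 0 := by linarith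
      exact (mul_eq_zero.1 this).resolve_left hf0
    · intro i hi
      have hi := Finset.mem_range.1 hi
      obtain ⟨j, hj | hj⟩ := Nat.even_or_odd' (i + 1)
      · rw [show 2 * k + 1 - (i + 1) = 2 * (k - j) + 1 by omega, ih (k - j) (by omega), mul_zero]
      · rw [hj, ih j (by omega), mul_zero, zero_mul]

open scoped ContDiff in
theorem iteratedDeriv_id_mul_deriv_zero {u : ℝ → ℝ} (hu : ContDiff ℝ ∞ u) (n : ℕ) :
    iteratedDeriv n (id * deriv u) 0 = n * iteratedDeriv n u 0 := by
  have hu' : ContDiff ℝ ∞ (deriv u) := (contDiff_infty_iff_deriv.1 hu).2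
  rw [iteratedDeriv_mul contDiff_id.contDiffAt (contDiff_infty.1 hu' _).contDiffAt]
  cases n with
  | zero => simp
  | succ n =>
    rw [Finset.sum_eq_single_of_mem 1 (by simp)]
    · simp [iteratedDeriv_id, iteratedDeriv_succ']
    · intro i _ hi
      simp [iteratedDeriv_id, hi]

open scoped ContDiff in
/-- Smooth solutions of `x u' = f u` are d-odd at `0` if `f` is d-even with `f 0 = 1`. -/
theorem iteratedDeriv_even_eq_zero_of_id_mul_deriv {f u : ℝ → ℝ} (hf : ContDiff ℝ ∞ f)
    (hu : ContDiff ℝ ∞ u) (hf0 : f 0 = 1)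
    (hodd : ∀ k : ℕ, iteratedDeriv (2 * k + 1) f 0 = 0) (h : id * deriv u = f * u) (k : ℕ) :
    iteratedDeriv (2 * k) u 0 = 0 := by
  induction k using Nat.strong_induction_on with
  | _ k ih =>
    have hk := iteratedDeriv_id_mul_deriv_zero hu (2 * k)
    rw [h, iteratedDeriv_mul (contDiff_infty.1 hf _).contDiffAt (contDiff_infty.1 hu _).contDiffAt,
      Finset.sum_range_succ', Finset.sum_eq_zero] at hk
    · simp only [Nat.choose_zero_right, Nat.cast_one, one_mul, Nat.sub_zero, iteratedDeriv_zero,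
        hf0, zero_add] at hk
      have h2 : ((2 * k : ℕ) : ℝ) - 1 ≠ 0 := by
        rw [sub_ne_zero]
        exact_mod_cast (by omega : 2 * k ≠ 1)
      have h3 : (((2 * k : ℕ) : ℝ) - 1) * iteratedDeriv (2 * k) u 0 = 0 := by linarith
      exact (mul_eq_zero.1 h3).resolve_left h2
    · intro i hi
      have hi := Finset.mem_range.1 hi
      obtain ⟨j, hj | hj⟩ := Nat.even_or_odd' (i + 1)
      · rw [show 2 * k - (i + 1) = 2 * (k - j) by omega, ih (k - j) (by omega), mul_zero]
      · rw [hj, hodd j, mul_zero, zero_mul]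

open scoped ContDiff in
theorem exists_contDiff_id_mul_deriv_eq {f : ℝ → ℝ} (hf : ContDiff ℝ ∞ f) (hf0 : f 0 = 1) :
    ∃ u : ℝ → ℝ, ContDiff ℝ ∞ u ∧ u 0 = 0 ∧ deriv u 0 = 1 ∧ id * deriv u = f * u := by
  obtain ⟨q, hq, hfq⟩ := exists_contDiff_eq_add_mul hf
  have hH : ∀ x, HasDerivAt (fun x => ∫ t in (0 : ℝ)..x, q t) (q x) x := fun x =>
    hq.continuous.integral_hasStrictDerivAt 0 x |>.hasDerivAt
  set H : ℝ → ℝ := fun x => ∫ t in (0 : ℝ)..x, q t with hHdef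
  have hHs : ContDiff ℝ ∞ H := by
    refine contDiff_infty_iff_deriv.2 ⟨fun x => (hH x).differentiableAt, ?_⟩
    rwa [funext fun x => (hH x).deriv]
  have hu : ∀ x, HasDerivAt (fun x => x * Real.exp (H x)) (f x * Real.exp (H x)) x := by
    intro x
    refine ((hasDerivAt_id' x).mul (hH x).exp).congr_deriv ?_
    rw [hfq x, hf0]
    ring
  refine ⟨fun x => x * Real.exp (H x), contDiff_id.mul hHs.exp, by simp, ?_, ?_⟩
  · rw [(hu 0).deriv]
    simp [hHdef, hf0]
  · ext x
    simp only [Pi.mul_apply, id, (hu x).deriv]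
    ring

open scoped ContDiff in
/-- A smooth germ that is positive near a point extends to a positive smooth function. -/
theorem exists_contDiff_pos_eventuallyEq {B : ℝ → ℝ} (hB : ContDiff ℝ ∞ B) {c : ℝ}
    (hpos : ∀ᶠ x in nhds c, 0 < B x) :
    ∃ b : ℝ → ℝ, ContDiff ℝ ∞ b ∧ (∀ x, 0 < b x) ∧ b =ᶠ[nhds c] B := by
  obtain ⟨δ, hδ, hball⟩ := Metric.eventually_nhds_iff.1 hpos
  let φ : ContDiffBump c := ⟨δ / 2, δ, half_pos hδ, half_lt_self hδ⟩
  refine ⟨fun x => φ x * B x + (1 - φ x), (φ.contDiff.mul hB).add (contDiff_const.sub φ.contDiff),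
    fun x => ?_, ?_⟩
  · have h0 : 0 ≤ φ x := φ.nonneg
    have h1 : φ x ≤ 1 := φ.le_one
    rcases lt_or_ge (dist x c) δ with hx | hx
    · have := hball hx
      rcases h0.eq_or_lt with h | h
      · simp [← h]
      · nlinarith [mul_pos h this]
    · simp [φ.zero_of_le_dist hx]
  · filter_upwards [φ.eventuallyEq_one] with x hx
    simp [hx]


/-- Existence of the isotropic radial coordinate: if `B` is smooth, `B 0 = 1`, `B` is
positive near `0` and d-even at `0`, then there is a smooth d-odd radial coordinate `r̃`
with `r̃ 0 = 0`, `r̃' 0 = 1`, solving `r r̃' = √(B r) r̃` for `r ∈ (0, ε)`. -/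
theorem exists_isotropic_radius (B : ℝ → ℝ) (hB : ContDiff ℝ (⊤ : ℕ∞) B) (hB0 : B 0 = 1)
    (hBpos : ∀ᶠ x in nhds (0 : ℝ), B x > 0)
    (hBe : ∀ k : ℕ, iteratedDeriv (2 * k + 1) B 0 = 0) :
    ∃ ε > (0 : ℝ), ∃ rt : ℝ → ℝ,
      ContDiffOn ℝ (⊤ : ℕ∞) rt (Set.Ioo (-ε) ε) ∧
      rt 0 = 0 ∧
      deriv rt 0 = 1 ∧
      (∀ k : ℕ, iteratedDeriv (2 * k) rt 0 = 0) ∧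
      ∀ r ∈ Set.Ioo (0 : ℝ) ε, r * deriv rt r = Real.sqrt (B r) * rt r := by
  obtain ⟨b, hb, hbpos, hbB⟩ := exists_contDiff_pos_eventuallyEq hB hBpos
  have hf := hb.sqrt fun x => (hbpos x).ne'
  have hf0 : Real.sqrt (b 0) = 1 := by rw [hbB.eq_of_nhds, hB0, Real.sqrt_one]
  have hsq : (fun x => Real.sqrt (b x)) * (fun x => Real.sqrt (b x)) = b :=
    funext fun x => Real.mul_self_sqrt (hbpos x).le
  have hodd := iteratedDeriv_odd_eq_zero_of_mul_self hf (by simp [hf0]) fun k => by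
    rw [hsq, hbB.iteratedDeriv_eq, hBe k]
  obtain ⟨u, hu, hu0, hu1, hode⟩ := exists_contDiff_id_mul_deriv_eq hf hf0
  obtain ⟨ε, hε, hball⟩ := Metric.eventually_nhds_iff.1 hbB
  refine ⟨ε, hε, u, hu.contDiffOn, hu0, hu1,
    iteratedDeriv_even_eq_zero_of_id_mul_deriv hf hu hf0 hodd hode, fun r hr => ?_⟩
  rw [← hball (by simpa [abs_of_pos hr.1] using hr.2)]
  exact congrFun hode r
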